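/- arXiv:0911.4058 — 2 statements merged into one kernel-verified Lean document; each statement's English description precedes it below -/
import Mathlib

section
/- Let r ≥ 4, let τ : Fin r → ℕ be any function, fix a linear order on ℙ¹(ℂ), and let x, x′ : Fin r → ℙ¹(ℂ) be injective functions into the complex projective line. For an injective y : Fin r → ℙ¹(ℂ), write ω(y) for the unique rearrangement y ∘ π of y with π a permutation of Fin r satisfying τ ∘ π = τ, such that for all i < j with τ(i) = τ(j) one has ω(y)(i) < ω(y)(j). Suppose θ₀ ∈ GL(2, ℂ) and a permutation π₀ of Fin r with τ ∘ π₀ = τ are such that the induced map of θ₀ on ℙ¹(ℂ) sends x′(i) to x(π₀(i)) for every i. Call a triple of pairwise distinct indices (i₁, i₂, i₃) 'admissible' if τ(i₁) = τ(0), τ(i₂) = τ(1), τ(i₃) = τ(2); let Θ be the set of induced maps of elements of GL(2, ℂ) that for some admissible triple send x(i₁), x(i₂), x(i₃) to 0 = [0:1], 1 = [1:1], ∞ = [1:0] respectively, and Θ′ the analogous set for x′. Then { ω(θ ∘ x) : θ ∈ Θ } = { ω(θ′ ∘ x′) : θ′ ∈ Θ′ } as sets of functions Fin r → ℙ¹(ℂ).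 -/
open scoped LinearAlgebra.Projectivization

/-- The map induced on the complex projective line `ℙ¹(ℂ) = ℙ ℂ (Fin 2 → ℂ)`
by an invertible matrix `g ∈ GL(2, ℂ)`. -/
noncomputable def projMap (g : GL (Fin 2) ℂ) :
    ℙ ℂ (Fin 2 → ℂ) → ℙ ℂ (Fin 2 → ℂ) :=
  Projectivization.map
    ((Matrix.GeneralLinearGroup.toLin g).toLinearEquiv :
      (Fin 2 → ℂ) →ₗ[ℂ] (Fin 2 → ℂ))
    (Matrix.GeneralLinearGroup.toLin g).toLinearEquiv.injective

/-- The point `0 = [0 : 1]` of `ℙ¹(ℂ)`. -/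
noncomputable def ptZero : ℙ ℂ (Fin 2 → ℂ) :=
  Projectivization.mk ℂ ![0, 1] (by intro h; simpa using congrFun h 1)

/-- The point `1 = [1 : 1]` of `ℙ¹(ℂ)`. -/
noncomputable def ptOne : ℙ ℂ (Fin 2 → ℂ) :=
  Projectivization.mk ℂ ![1, 1] (by intro h; simpa using congrFun h 0)

/-- The point `∞ = [1 : 0]` of `ℙ¹(ℂ)`. -/
noncomputable def ptInf : ℙ ℂ (Fin 2 → ℂ) :=
  Projectivization.mk ℂ ![1, 0] (by intro h; simpa using congrFun h 0)

/-- A triple of pairwise distinct indices `(i₁, i₂, i₃)` in `Fin r` is admissible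
for the labeling `τ` if its labels agree with those of the first three indices. -/
def Admissible {r : ℕ} (hr : 4 ≤ r) (τ : Fin r → ℕ) (i₁ i₂ i₃ : Fin r) : Prop :=
  i₁ ≠ i₂ ∧ i₁ ≠ i₃ ∧ i₂ ≠ i₃ ∧
    τ i₁ = τ ⟨0, by omega⟩ ∧ τ i₂ = τ ⟨1, by omega⟩ ∧ τ i₃ = τ ⟨2, by omega⟩

/-- The set `Θ` of induced maps on `ℙ¹(ℂ)` of elements of `GL(2, ℂ)` that carry
`x i₁, x i₂, x i₃` to `0, 1, ∞` for some admissible triple `(i₁, i₂, i₃)`. -/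
def ThetaSet {r : ℕ} (hr : 4 ≤ r) (τ : Fin r → ℕ)
    (x : Fin r → ℙ ℂ (Fin 2 → ℂ)) :
    Set (ℙ ℂ (Fin 2 → ℂ) → ℙ ℂ (Fin 2 → ℂ)) :=
  {f | ∃ g : GL (Fin 2) ℂ, f = projMap g ∧
    ∃ i₁ i₂ i₃ : Fin r, Admissible hr τ i₁ i₂ i₃ ∧
      f (x i₁) = ptZero ∧ f (x i₂) = ptOne ∧ f (x i₃) = ptInf}

/-- `z` is the `τ`-ordered rearrangement of `y`: it is obtained from `y` by a
permutation preserving the labeling `τ`, and it is strictly increasing within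
each `τ`-class.  For injective `y` there is exactly one such `z`, written `ω(y)`. -/
def IsOrderedRearrangement {α : Type*} [LinearOrder α] {r : ℕ}
    (τ : Fin r → ℕ) (y z : Fin r → α) : Prop :=
  (∃ π : Equiv.Perm (Fin r), τ ∘ π = τ ∧ z = y ∘ π) ∧
    ∀ i j : Fin r, i < j → τ i = τ j → z i < z j

theorem projMap_mul (g h : GL (Fin 2) ℂ) : projMap (g * h) = projMap g ∘ projMap h := by
  funext p
  induction p using Projectivization.ind with
  | h v hv =>
    simp [projMap, Projectivization.map_mk]

theorem projMap_one : projMap 1 = id := by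
  funext p
  induction p using Projectivization.ind with
  | h v hv =>
    simp [projMap, Projectivization.map_mk]

/-- Precomposition with `g` turns the normalizing maps of `x` into those of a sequence `x'`
carried onto `x` by `g` up to a `τ`-preserving permutation. -/
theorem comp_projMap_mem_thetaSet {r : ℕ} (hr : 4 ≤ r) {τ : Fin r → ℕ}
    {x x' : Fin r → ℙ ℂ (Fin 2 → ℂ)} {g : GL (Fin 2) ℂ} {π : Equiv.Perm (Fin r)}
    (hπ : τ ∘ π = τ) (hg : projMap g ∘ x' = x ∘ π)
    {f : ℙ ℂ (Fin 2 → ℂ) → ℙ ℂ (Fin 2 → ℂ)} (hf : f ∈ ThetaSet hr τ x) :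
    f ∘ projMap g ∈ ThetaSet hr τ x' := by
  obtain ⟨h, rfl, i₁, i₂, i₃, ⟨h₁₂, h₁₃, h₂₃, t₁, t₂, t₃⟩, e₁, e₂, e₃⟩ := hf
  have hτ (i : Fin r) : τ (π.symm i) = τ i := by
    simpa using (congrFun hπ (π.symm i)).symm
  have hx (i : Fin r) : projMap g (x' (π.symm i)) = x i := by
    simpa using congrFun hg (π.symm i)
  refine ⟨h * g, (projMap_mul h g).symm, π.symm i₁, π.symm i₂, π.symm i₃, ?_, ?_⟩
  · simp [Admissible, *]
  · simp [*]

theorem IsOrderedRearrangement.of_comp_perm {α : Type*} [LinearOrder α] {r : ℕ}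
    {τ : Fin r → ℕ} {y z : Fin r → α} {π : Equiv.Perm (Fin r)} (hπ : τ ∘ π = τ)
    (h : IsOrderedRearrangement τ y z) : IsOrderedRearrangement τ (y ∘ π) z := by
  obtain ⟨⟨σ, hσ, rfl⟩, hlt⟩ := h
  refine ⟨⟨σ.trans π.symm, ?_, ?_⟩, hlt⟩
  · funext i
    have h₁ := congrFun hπ (π.symm (σ i))
    have h₂ := congrFun hσ i
    simp_all
  · funext i
    simp

theorem setOf_isOrderedRearrangement_subset [LinearOrder (ℙ ℂ (Fin 2 → ℂ))]
    {r : ℕ} (hr : 4 ≤ r) {τ : Fin r → ℕ} {x x' : Fin r → ℙ ℂ (Fin 2 → ℂ)}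
    {g : GL (Fin 2) ℂ} {π : Equiv.Perm (Fin r)}
    (hπ : τ ∘ π = τ) (hg : projMap g ∘ x' = x ∘ π) :
    {z | ∃ θ ∈ ThetaSet hr τ x, IsOrderedRearrangement τ (θ ∘ x) z} ⊆
      {z | ∃ θ ∈ ThetaSet hr τ x', IsOrderedRearrangement τ (θ ∘ x') z} := by
  rintro z ⟨θ, hθ, hz⟩
  refine ⟨θ ∘ projMap g, comp_projMap_mem_thetaSet hr hπ hg hθ, ?_⟩
  rw [Function.comp_assoc, hg]
  exact hz.of_comp_perm hπ

/-- **The identity `ω(Θ x) = ω(Θ′ x′)` in the proof of Proposition 2.** Fixing a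
linear order on `ℙ¹(ℂ)`, if the induced map of `θ₀ ∈ GL(2, ℂ)` carries the injective
sequence `x′` onto the injective sequence `x` up to a `τ`-preserving permutation `π₀`,
then the set of `τ`-ordered rearrangements `ω(θ ∘ x)` for `θ ∈ Θ` equals the set of
`τ`-ordered rearrangements `ω(θ′ ∘ x′)` for `θ′ ∈ Θ′`. -/
theorem omega_thetaSet_eq
    [inst : LinearOrder (ℙ ℂ (Fin 2 → ℂ))]
    (r : ℕ) (hr : 4 ≤ r) (τ : Fin r → ℕ)
    (x x' : Fin r → ℙ ℂ (Fin 2 → ℂ))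
    (hx : Function.Injective x) (hx' : Function.Injective x')
    (θ₀ : GL (Fin 2) ℂ) (π₀ : Equiv.Perm (Fin r)) (hπ₀ : τ ∘ π₀ = τ)
    (hθ₀ : ∀ i : Fin r, projMap θ₀ (x' i) = x (π₀ i)) :
    {z : Fin r → ℙ ℂ (Fin 2 → ℂ) |
        ∃ θ ∈ ThetaSet hr τ x, IsOrderedRearrangement τ (θ ∘ x) z} =
      {z : Fin r → ℙ ℂ (Fin 2 → ℂ) |
        ∃ θ' ∈ ThetaSet hr τ x', IsOrderedRearrangement τ (θ' ∘ x') z} := by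
  refine (setOf_isOrderedRearrangement_subset hr hπ₀ (funext hθ₀)).antisymm
    (setOf_isOrderedRearrangement_subset hr (g := θ₀⁻¹) (π := π₀.symm) ?_ ?_)
  · funext i
    simpa using (congrFun hπ₀ (π₀.symm i)).symm
  · funext i
    have hinv : projMap θ₀⁻¹ ∘ projMap θ₀ = id := by
      rw [← projMap_mul, inv_mul_cancel, projMap_one]
    simpa [hθ₀] using congrFun hinv (x' (π₀.symm i))
end

section
/- In the triple tensor product V = (Fin 2 → ℂ) ⊗[ℂ] (Fin 2 → ℂ) ⊗[ℂ] (Fin 3 → ℂ) with standard basis vectors eᵢ, the tensor T = e₀ ⊗ e₀ ⊗ e₁ + e₁ ⊗ e₀ ⊗ e₀ + e₁ ⊗ e₁ ⊗ e₂ has tensor rank exactly three: T is a sum of three simple tensors a ⊗ b ⊗ c, but T cannot be written as a sum of two simple tensors, i.e., there do not exist vectors a₁, a₂ ∈ (Fin 2 → ℂ), b₁, b₂ ∈ (Fin 2 → ℂ), c₁, c₂ ∈ (Fin 3 → ℂ) with T = a₁ ⊗ b₁ ⊗ c₁ + a₂ ⊗ b₂ ⊗ c₂. -/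
open scoped TensorProduct

/-- The `i`-th standard basis vector of `Fin n → ℂ`. -/
noncomputable def e (n : ℕ) (i : Fin n) : Fin n → ℂ := Pi.single i 1

/-- The state `|001⟩ + |100⟩ + |112⟩`, representative of the SLOCC class (ABC-3)
in `2 ⊗ 2 ⊗ 3` systems, as an element of
`(Fin 2 → ℂ) ⊗[ℂ] (Fin 2 → ℂ) ⊗[ℂ] (Fin 3 → ℂ)`. -/
noncomputable def T : (Fin 2 → ℂ) ⊗[ℂ] ((Fin 2 → ℂ) ⊗[ℂ] (Fin 3 → ℂ)) :=
  e 2 0 ⊗ₜ[ℂ] (e 2 0 ⊗ₜ[ℂ] e 3 1) + e 2 1 ⊗ₜ[ℂ] (e 2 0 ⊗ₜ[ℂ] e 3 0) +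
    e 2 1 ⊗ₜ[ℂ] (e 2 1 ⊗ₜ[ℂ] e 3 2)

/-- Contraction of the first two tensor factors against the `i`-th and `j`-th coordinate
functionals. -/
noncomputable def contract (m n p : ℕ) (i : Fin m) (j : Fin n) :
    (Fin m → ℂ) ⊗[ℂ] ((Fin n → ℂ) ⊗[ℂ] (Fin p → ℂ)) →ₗ[ℂ] (Fin p → ℂ) :=
  TensorProduct.lift ((LinearMap.lsmul ℂ _).comp (LinearMap.proj i)) ∘ₗ
    TensorProduct.map LinearMap.id
      (TensorProduct.lift ((LinearMap.lsmul ℂ _).comp (LinearMap.proj j)))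

@[simp]
lemma contract_tmul (m n p : ℕ) (i : Fin m) (j : Fin n) (a : Fin m → ℂ) (b : Fin n → ℂ)
    (c : Fin p → ℂ) : contract m n p i j (a ⊗ₜ[ℂ] (b ⊗ₜ[ℂ] c)) = a i • b j • c := by
  simp [contract, smul_comm (b j) (a i) c]

/-- Every contraction of a sum of two simple tensors lies in the span of their last factors. -/
lemma contract_mem_span_pair {m n p : ℕ} (i : Fin m) (j : Fin n) (a₁ a₂ : Fin m → ℂ)
    (b₁ b₂ : Fin n → ℂ) (c₁ c₂ : Fin p → ℂ) :
    contract m n p i j (a₁ ⊗ₜ[ℂ] (b₁ ⊗ₜ[ℂ] c₁) + a₂ ⊗ₜ[ℂ] (b₂ ⊗ₜ[ℂ] c₂)) ∈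
      Submodule.span ℂ {c₁, c₂} :=
  Submodule.mem_span_pair.2 ⟨a₁ i * b₁ j, a₂ i * b₂ j, by simp [mul_smul]⟩

lemma contract_T_zero_zero : contract 2 2 3 0 0 T = e 3 1 := by
  simp [T, e]

lemma contract_T_one_zero : contract 2 2 3 1 0 T = e 3 0 := by
  simp [T, e]

lemma contract_T_one_one : contract 2 2 3 1 1 T = e 3 2 := by
  simp [T, e]

/-- **The tensor `|001⟩ + |100⟩ + |112⟩` has tensor rank exactly three.**
It is a sum of three simple tensors, but it is not a sum of two simple tensors. -/
theorem tensorRank_T_eq_three :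
    (∃ (a b : Fin 3 → (Fin 2 → ℂ)) (c : Fin 3 → (Fin 3 → ℂ)),
        T = ∑ k : Fin 3, a k ⊗ₜ[ℂ] (b k ⊗ₜ[ℂ] c k)) ∧
      ¬ ∃ (a₁ a₂ b₁ b₂ : Fin 2 → ℂ) (c₁ c₂ : Fin 3 → ℂ),
          T = a₁ ⊗ₜ[ℂ] (b₁ ⊗ₜ[ℂ] c₁) + a₂ ⊗ₜ[ℂ] (b₂ ⊗ₜ[ℂ] c₂) := by
  refine ⟨⟨![e 2 0, e 2 1, e 2 1], ![e 2 0, e 2 0, e 2 1], ![e 3 1, e 3 0, e 3 2], ?_⟩, ?_⟩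
  · simp [T, Fin.sum_univ_three]
  · rintro ⟨a₁, a₂, b₁, b₂, c₁, c₂, hT⟩
    have hmem (i j : Fin 2) : contract 2 2 3 i j T ∈ Submodule.span ℂ {c₁, c₂} :=
      hT ▸ contract_mem_span_pair i j a₁ a₂ b₁ b₂ c₁ c₂
    have hbasis (k : Fin 3) : Pi.basisFun ℂ (Fin 3) k ∈ Submodule.span ℂ {c₁, c₂} := by
      rw [Pi.basisFun_apply]
      change e 3 k ∈ _
      fin_cases k
      · simpa [contract_T_one_zero] using hmem 1 0
      · simpa [contract_T_zero_zero] using hmem 0 0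
      · simpa [contract_T_one_one] using hmem 1 1
    have htop : Submodule.span ℂ {c₁, c₂} = ⊤ := by
      rw [eq_top_iff, ← (Pi.basisFun ℂ (Fin 3)).span_eq, Submodule.span_le]
      exact Set.range_subset_iff.2 hbasis
    classical
    have hrank := finrank_span_finset_le_card (R := ℂ) ({c₁, c₂} : Finset (Fin 3 → ℂ))
    rw [Set.finrank, Finset.coe_pair, htop, finrank_top, Module.finrank_fin_fun] at hrank
    exact absurd (hrank.trans Finset.card_le_two) (by norm_num)
end
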